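/- arXiv:2312.08024 — 2 statements merged into one kernel-verified Lean document; each statement's English description precedes it below -/
import Mathlib

section
/- Let n ≥ 4 be an integer, D > 1, ρ > 0, and let φ : ℝ^{n−1} → ℝ be a function that is nonnegative on the ball B'(0,ρ) = {x̄ ∈ ℝ^{n−1} : |x̄| < ρ} and for which there exist k₁, …, k_{n−1} > 0 and C₀ > 0 with |φ(x̄) − Σ_{i=1}^{n−1} k_i x_i²| ≤ C₀ |x̄|³ for all |x̄| < ρ. Let Σ = {(x̄, x_n) : |x̄| < ρ and 0 < x_n < φ(x̄)}. Then, as δ → 0⁺, ∫_Σ U_{δ,0}(x)^{2n/(n−2)} dx = δ · α_n^{2n/(n−2)} · ((k₁ + ⋯ + k_{n−1})/(n−1)) · β²_n(D) + O(δ²). -/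
open MeasureTheory Real Set Filter Asymptotics Topology

noncomputable section

/-- `α_n = (4n(n-1))^((n-2)/4)`. -/
def alphaN (n : ℕ) : ℝ := (4*(n:ℝ)*((n:ℝ)-1)) ^ (((n:ℝ)-2)/4)

/-- The bubble `U_{δ,ξ}` on the half-space, points written as `(x̄, xₙ)`. -/
def bubble (n : ℕ) (D δ : ℝ) (ξ : EuclideanSpace ℝ (Fin (n-1)))
    (x : EuclideanSpace ℝ (Fin (n-1)) × ℝ) : ℝ :=
  alphaN n * δ ^ (((n:ℝ)-2)/2) /
    (‖x.1 - ξ‖^2 + (x.2 + δ*D)^2 - δ^2) ^ (((n:ℝ)-2)/2)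

/-- `β²_n(D) = ∫_{ℝ^{n-1}} |ȳ|² (|ȳ|² + D² - 1)^{-n} dȳ`. -/
def beta2 (n : ℕ) (D : ℝ) : ℝ :=
  ∫ y : EuclideanSpace ℝ (Fin (n-1)), ‖y‖^2 * (‖y‖^2 + D^2 - 1) ^ (-(n:ℝ))

/-- The weight `(‖x‖² + a)⁻ⁿ`. -/
def weight {E : Type*} [Norm E] (n : ℕ) (a : ℝ) (x : E) : ℝ := ((‖x‖ ^ 2 + a) ^ n)⁻¹

theorem weight_pos {E : Type*} [NormedAddCommGroup E] (n : ℕ) {a : ℝ} (ha : 0 < a) (x : E) :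
    0 < weight n a x := by
  unfold weight; positivity

theorem continuous_weight {E : Type*} [NormedAddCommGroup E] (n : ℕ) {a : ℝ} (ha : 0 < a) :
    Continuous (weight n a : E → ℝ) := by
  unfold weight
  refine Continuous.inv₀ (by fun_prop) fun x => ?_
  positivity

theorem integrable_mul_weight {n : ℕ} (hn : 4 ≤ n) {a c : ℝ} (ha : 0 < a)
    {P : EuclideanSpace ℝ (Fin (n-1)) → ℝ} (hP : Continuous P)
    (hPc : ∀ x, |P x| ≤ c * (1 + ‖x‖ ^ 2) ^ 2) :
    Integrable (fun x => P x * weight n a x) := by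
  have hint : Integrable (fun x : EuclideanSpace ℝ (Fin (n-1)) =>
      (1 + ‖x‖ ^ 2) ^ (-(2 * ((n:ℝ) - 2)) / 2)) := by
    refine integrable_rpow_neg_one_add_norm_sq ?_
    have h4 : (4:ℝ) ≤ n := by exact_mod_cast hn
    rw [finrank_euclideanSpace_fin, Nat.cast_sub (by omega)]
    push_cast
    linarith
  set b := min a 1 with hb
  have hb0 : 0 < b := lt_min ha one_pos
  refine (hint.const_mul (c * (b ^ n)⁻¹)).mono'
    (hP.mul (continuous_weight n ha)).aestronglyMeasurable (ae_of_all _ fun x => ?_)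
  have h1 : 0 < 1 + ‖x‖ ^ 2 := by positivity
  have hw : weight n a x ≤ (b ^ n)⁻¹ * ((1 + ‖x‖ ^ 2) ^ n)⁻¹ := by
    rw [weight, ← mul_inv, ← mul_pow]
    refine inv_anti₀ (by positivity) (pow_le_pow_left₀ (by positivity) ?_ n)
    nlinarith [min_le_left a 1, min_le_right a 1, sq_nonneg ‖x‖]
  have hexp : (1 + ‖x‖ ^ 2) ^ (-(2 * ((n:ℝ) - 2)) / 2)
      = (1 + ‖x‖ ^ 2) ^ 2 * ((1 + ‖x‖ ^ 2) ^ n)⁻¹ := by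
    rw [show -(2 * ((n:ℝ) - 2)) / 2 = ((2:ℕ):ℝ) + -(n:ℝ) by push_cast; ring,
      Real.rpow_add h1, Real.rpow_neg h1.le, Real.rpow_natCast, Real.rpow_natCast]
  rw [Real.norm_eq_abs, abs_mul, abs_of_pos (weight_pos n ha x), hexp]
  calc |P x| * weight n a x
      ≤ (c * (1 + ‖x‖ ^ 2) ^ 2) * ((b ^ n)⁻¹ * ((1 + ‖x‖ ^ 2) ^ n)⁻¹) :=
        mul_le_mul (hPc x) hw (weight_pos n ha x).le ((abs_nonneg _).trans (hPc x))
    _ = _ := by ring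

theorem weight_smul {E : Type*} [NormedAddCommGroup E] [NormedSpace ℝ E] (n : ℕ) (a : ℝ)
    {δ : ℝ} (x : E) :
    weight n (δ ^ 2 * a) (δ • x) = (δ ^ (2 * n))⁻¹ * weight n a x := by
  rw [weight, weight, norm_smul, mul_pow, Real.norm_eq_abs, sq_abs, ← mul_add, mul_pow, mul_inv,
    ← pow_mul]

theorem integral_homogeneous_mul_weight {n j : ℕ} (hn : 1 ≤ n) (a : ℝ) {δ : ℝ} (hδ : 0 < δ)
    {P : EuclideanSpace ℝ (Fin (n-1)) → ℝ} (hP : ∀ x, P (δ • x) = δ ^ j * P x) :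
    δ ^ (n + 1) * ∫ x, P x * weight n (δ ^ 2 * a) x = δ ^ j * ∫ x, P x * weight n a x := by
  have h := Measure.integral_comp_smul (volume : Measure (EuclideanSpace ℝ (Fin (n-1))))
    (fun x => P x * weight n (δ ^ 2 * a) x) δ
  simp only [hP, weight_smul] at h
  rw [finrank_euclideanSpace_fin, abs_of_pos (by positivity), smul_eq_mul] at h
  have h2 : ∀ x : EuclideanSpace ℝ (Fin (n-1)),
      δ ^ j * P x * ((δ ^ (2 * n))⁻¹ * weight n a x)
        = (δ ^ j * (δ ^ (2 * n))⁻¹) * (P x * weight n a x) := fun x => by ring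
  simp only [h2, integral_const_mul] at h
  obtain ⟨m, rfl⟩ := Nat.exists_eq_add_of_le' hn
  simp only [Nat.add_sub_cancel] at h ⊢
  field_simp at h
  refine mul_left_cancel₀ (pow_pos hδ m).ne' ?_
  linear_combination -h

theorem integral_coord_sq_mul_weight (m n : ℕ) (a : ℝ) (i j : Fin m) :
    ∫ x : EuclideanSpace ℝ (Fin m), x i ^ 2 * weight n a x
      = ∫ x : EuclideanSpace ℝ (Fin m), x j ^ 2 * weight n a x := by
  let e := LinearIsometryEquiv.piLpCongrLeft 2 ℝ ℝ (Equiv.swap i j)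
  have h := e.measurePreserving.integral_comp e.toHomeomorph.measurableEmbedding
    (fun x : EuclideanSpace ℝ (Fin m) => x i ^ 2 * weight n a x)
  rw [← h]
  refine integral_congr_ae (ae_of_all _ fun x => ?_)
  have h1 : (e x) i = x j := by
    simp [e, LinearIsometryEquiv.piLpCongrLeft_apply, Equiv.piCongrLeft']
  simp only [h1, weight, e.norm_map]

theorem abs_sum_mul_sq_le {m : ℕ} {k : Fin m → ℝ} (hk : ∀ i, 0 < k i)
    (x : EuclideanSpace ℝ (Fin m)) :
    |∑ i, k i * x i ^ 2| ≤ (∑ i, k i) * ‖x‖ ^ 2 := by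
  rw [abs_of_nonneg (Finset.sum_nonneg fun i _ => mul_nonneg (hk i).le (sq_nonneg _)),
    Finset.sum_mul]
  refine Finset.sum_le_sum fun i _ => mul_le_mul_of_nonneg_left ?_ (hk i).le
  rw [EuclideanSpace.real_norm_sq_eq]
  exact Finset.single_le_sum (f := fun i => x i ^ 2) (fun j _ => sq_nonneg _) (Finset.mem_univ i)

theorem beta2_eq (n : ℕ) {D : ℝ} (hD : 1 < D) :
    beta2 n D = ∫ y : EuclideanSpace ℝ (Fin (n-1)), ‖y‖ ^ 2 * weight n (D ^ 2 - 1) y := by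
  refine integral_congr_ae (ae_of_all _ fun y => ?_)
  have h : 0 ≤ ‖y‖ ^ 2 + D ^ 2 - 1 := by nlinarith [sq_nonneg ‖y‖]
  simp only [weight]
  rw [Real.rpow_neg h, Real.rpow_natCast, add_sub_assoc]

theorem integrable_norm_pow_mul_weight {n j : ℕ} (hn : 4 ≤ n) (hj : j ≤ 4) {a : ℝ} (ha : 0 < a) :
    Integrable (fun x : EuclideanSpace ℝ (Fin (n-1)) => ‖x‖ ^ j * weight n a x) := by
  refine integrable_mul_weight (c := 2) hn ha (by fun_prop) fun x => ?_
  rw [abs_of_nonneg (by positivity)]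
  have h : ‖x‖ ^ j ≤ 1 + ‖x‖ ^ 4 := by
    rcases le_total ‖x‖ 1 with h | h
    · linarith [pow_le_one₀ (n := j) (norm_nonneg x) h, pow_nonneg (norm_nonneg x) 4]
    · linarith [pow_le_pow_right₀ h hj]
  nlinarith [sq_nonneg ‖x‖, pow_nonneg (norm_nonneg x) 4]

theorem integrable_quadratic_mul_weight {n : ℕ} (hn : 4 ≤ n) {a : ℝ} (ha : 0 < a)
    {k : Fin (n-1) → ℝ} (hk : ∀ i, 0 < k i) :
    Integrable (fun x : EuclideanSpace ℝ (Fin (n-1)) => (∑ i, k i * x i ^ 2) * weight n a x) := by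
  refine integrable_mul_weight (c := ∑ i, k i) hn ha (by fun_prop) fun x => ?_
  refine (abs_sum_mul_sq_le hk x).trans
    (mul_le_mul_of_nonneg_left ?_ (Finset.sum_nonneg fun i _ => (hk i).le))
  nlinarith [sq_nonneg ‖x‖, sq_nonneg (‖x‖ ^ 2)]

theorem integral_quadratic_mul_weight {n : ℕ} (hn : 4 ≤ n) {D : ℝ} (hD : 1 < D)
    (k : Fin (n-1) → ℝ) :
    ∫ x : EuclideanSpace ℝ (Fin (n-1)), (∑ i, k i * x i ^ 2) * weight n (D ^ 2 - 1) x
      = (∑ i, k i) / ((n:ℝ) - 1) * beta2 n D := by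
  have ha : 0 < D ^ 2 - 1 := by nlinarith
  have hi : ∀ i, Integrable (fun x : EuclideanSpace ℝ (Fin (n-1)) =>
      x i ^ 2 * weight n (D ^ 2 - 1) x) := fun i => by
    refine integrable_mul_weight (c := 1) hn ha (by fun_prop) fun x => ?_
    rw [abs_of_nonneg (sq_nonneg _)]
    have h := Finset.single_le_sum (f := fun i => x i ^ 2) (fun j _ => sq_nonneg _)
      (Finset.mem_univ i)
    simp only [← EuclideanSpace.real_norm_sq_eq] at h
    nlinarith [sq_nonneg ‖x‖, sq_nonneg (‖x‖ ^ 2)]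
  let i₀ : Fin (n-1) := ⟨0, by omega⟩
  have hβ : beta2 n D = ((n:ℝ) - 1) *
      ∫ x : EuclideanSpace ℝ (Fin (n-1)), x i₀ ^ 2 * weight n (D ^ 2 - 1) x := by
    rw [beta2_eq n hD]
    simp only [EuclideanSpace.real_norm_sq_eq, Finset.sum_mul]
    rw [integral_finsetSum _ fun i _ => hi i,
      Finset.sum_congr rfl fun i _ => integral_coord_sq_mul_weight (n-1) n _ i i₀]
    simp [Nat.cast_sub (show 1 ≤ n by omega)]
  have hn1 : (n:ℝ) - 1 ≠ 0 := by
    have : (4:ℝ) ≤ n := by exact_mod_cast hn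
    linarith
  simp only [Finset.sum_mul, mul_assoc]
  rw [integral_finsetSum _ fun i _ => (hi i).const_mul (k i)]
  simp only [integral_const_mul]
  rw [Finset.sum_congr rfl fun i _ => by rw [integral_coord_sq_mul_weight (n-1) n _ i i₀],
    ← Finset.sum_mul, hβ]
  field_simp

theorem bubble_rpow {n : ℕ} (hn : 3 ≤ n) {D δ t : ℝ} (hD : 1 < D) (hδ : 0 < δ) (ht : 0 < t)
    (x : EuclideanSpace ℝ (Fin (n-1))) :
    bubble n D δ 0 (x, t) ^ ((2*(n:ℝ))/((n:ℝ)-2))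
      = alphaN n ^ ((2*(n:ℝ))/((n:ℝ)-2)) * δ ^ n * weight n ((t + δ * D) ^ 2 - δ ^ 2) x := by
  have hn3 : (3:ℝ) ≤ n := by exact_mod_cast hn
  have hα : 0 ≤ alphaN n := by
    unfold alphaN
    exact Real.rpow_nonneg (by nlinarith) _
  have hB : 0 ≤ ‖x‖ ^ 2 + ((t + δ * D) ^ 2 - δ ^ 2) := by
    nlinarith [sq_nonneg ‖x‖, mul_pos hδ (sub_pos.2 hD)]
  have he : ((n:ℝ) - 2) / 2 * (2 * (n:ℝ) / ((n:ℝ) - 2)) = n := by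
    have : (n:ℝ) - 2 ≠ 0 := by linarith
    field_simp
  simp only [bubble, sub_zero, weight, add_sub_assoc]
  rw [Real.div_rpow (by positivity) (Real.rpow_nonneg hB _), Real.mul_rpow hα (by positivity),
    ← Real.rpow_mul hδ.le, ← Real.rpow_mul hB, he, Real.rpow_natCast, Real.rpow_natCast,
    div_eq_mul_inv]

section Subgraph

variable {X : Type*} [MeasurableSpace X] {μ : Measure X}

theorem setLIntegral_subgraph [SFinite μ] {u : X → ℝ} (hu : Measurable u) {f : X × ℝ → ENNReal}
    (hf : Measurable f) :
    ∫⁻ p in {p : X × ℝ | 0 < p.2 ∧ p.2 < u p.1}, f p ∂(μ.prod volume)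
      = ∫⁻ x, (∫⁻ t in Ioo 0 (u x), f (x, t)) ∂μ := by
  have hT : MeasurableSet {p : X × ℝ | 0 < p.2 ∧ p.2 < u p.1} :=
    (measurableSet_lt measurable_const measurable_snd).inter
      (measurableSet_lt measurable_snd (hu.comp measurable_fst))
  rw [← lintegral_indicator hT, lintegral_prod _ (hf.indicator hT).aemeasurable]
  refine lintegral_congr fun x => ?_
  rw [← lintegral_indicator measurableSet_Ioo]
  rfl

theorem ae_restrict_of_snd_pos {S : Set (X × ℝ)} (hS : ∀ p ∈ S, 0 < p.2) :
    ∀ᵐ p ∂((μ.prod volume).restrict S), 0 < p.2 :=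
  ae_mono (Measure.restrict_mono hS le_rfl)
    (ae_restrict_mem (measurableSet_lt measurable_const measurable_snd))

theorem setLIntegral_le_of_subset_subgraph [SFinite μ] {u g : X → ℝ} (hu : Measurable u)
    (hu0 : ∀ x, 0 ≤ u x) {f : X × ℝ → ℝ} (hf : Measurable f)
    {S : Set (X × ℝ)} (hS : ∀ p ∈ S, 0 < p.2 ∧ p.2 < u p.1)
    (hfg : ∀ x t, 0 < t → f (x, t) ≤ g x) (hug : Integrable (fun x => u x * g x) μ)
    (hg : ∀ x, 0 ≤ g x) :
    ∫⁻ p in S, ENNReal.ofReal (f p) ∂(μ.prod volume)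
      ≤ ENNReal.ofReal (∫ x, u x * g x ∂μ) := by
  refine (lintegral_mono_set (t := {p : X × ℝ | 0 < p.2 ∧ p.2 < u p.1}) hS).trans ?_
  rw [setLIntegral_subgraph hu hf.ennreal_ofReal,
    ofReal_integral_eq_lintegral_ofReal hug (ae_of_all _ fun x => mul_nonneg (hu0 x) (hg x))]
  refine lintegral_mono fun x => ?_
  calc ∫⁻ t in Ioo 0 (u x), ENNReal.ofReal (f (x, t))
      ≤ ∫⁻ t in Ioo 0 (u x), ENNReal.ofReal (g x) :=
        setLIntegral_mono' measurableSet_Ioo fun t ht => ENNReal.ofReal_le_ofReal (hfg x t ht.1)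
    _ = _ := by
      rw [setLIntegral_const, Real.volume_Ioo, sub_zero, ← ENNReal.ofReal_mul (hg x), mul_comm]

theorem integrableOn_of_subset_subgraph [SFinite μ] {u g : X → ℝ} (hu : Measurable u)
    (hu0 : ∀ x, 0 ≤ u x) {f : X × ℝ → ℝ} (hf : Measurable f)
    (hf0 : ∀ x t, 0 < t → 0 ≤ f (x, t))
    {S : Set (X × ℝ)} (hS : ∀ p ∈ S, 0 < p.2 ∧ p.2 < u p.1)
    (hfg : ∀ x t, 0 < t → f (x, t) ≤ g x) (hug : Integrable (fun x => u x * g x) μ)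
    (hg : ∀ x, 0 ≤ g x) :
    IntegrableOn f S (μ.prod volume) := by
  refine ⟨hf.aestronglyMeasurable, ?_⟩
  rw [hasFiniteIntegral_iff_ofReal
    ((ae_restrict_of_snd_pos fun p hp => (hS p hp).1).mono fun p hp => hf0 _ _ hp)]
  exact (setLIntegral_le_of_subset_subgraph hu hu0 hf hS hfg hug hg).trans_lt
    ENNReal.ofReal_lt_top

theorem setIntegral_le_of_subset_subgraph [SFinite μ] {u g : X → ℝ} (hu : Measurable u)
    (hu0 : ∀ x, 0 ≤ u x) {f : X × ℝ → ℝ} (hf : Measurable f)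
    (hf0 : ∀ x t, 0 < t → 0 ≤ f (x, t))
    {S : Set (X × ℝ)} (hS : ∀ p ∈ S, 0 < p.2 ∧ p.2 < u p.1)
    (hfg : ∀ x t, 0 < t → f (x, t) ≤ g x) (hug : Integrable (fun x => u x * g x) μ)
    (hg : ∀ x, 0 ≤ g x) :
    ∫ p in S, f p ∂(μ.prod volume) ≤ ∫ x, u x * g x ∂μ := by
  rw [← ENNReal.ofReal_le_ofReal_iff (integral_nonneg fun x => mul_nonneg (hu0 x) (hg x)),
    ofReal_integral_eq_lintegral_ofReal
      (integrableOn_of_subset_subgraph hu hu0 hf hf0 hS hfg hug hg)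
      ((ae_restrict_of_snd_pos fun p hp => (hS p hp).1).mono fun p hp => hf0 _ _ hp)]
  exact setLIntegral_le_of_subset_subgraph hu hu0 hf hS hfg hug hg

theorem le_setIntegral_of_subgraph_subset [SFinite μ] {v g G : X → ℝ} (hv : Measurable v)
    {f : X × ℝ → ℝ} (hf : Measurable f) (hf0 : ∀ x t, 0 < t → 0 ≤ f (x, t))
    {S : Set (X × ℝ)} (hS0 : ∀ p ∈ S, 0 < p.2)
    (hS : {p : X × ℝ | 0 < p.2 ∧ p.2 < v p.1} ⊆ S) (hfS : IntegrableOn f S (μ.prod volume))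
    (hgf : ∀ x t, 0 < t → t < v x → g x ≤ f (x, t))
    (hG : Integrable G μ) (hG1 : ∀ x, 0 < v x → G x ≤ v x * g x)
    (hG0 : ∀ x, v x ≤ 0 → G x ≤ 0) :
    ∫ x, G x ∂μ ≤ ∫ p in S, f p ∂(μ.prod volume) := by
  have hae := (ae_restrict_of_snd_pos (μ := μ) hS0).mono fun p hp => hf0 p.1 p.2 hp
  refine (integral_mono hG hG.pos_part fun x => le_max_left _ _).trans ?_
  rw [← ENNReal.ofReal_le_ofReal_iff (integral_nonneg_of_ae hae),
    ofReal_integral_eq_lintegral_ofReal hfS hae,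
    ofReal_integral_eq_lintegral_ofReal hG.pos_part (ae_of_all _ fun x => le_max_right _ _)]
  refine le_trans ?_ (lintegral_mono_set hS)
  rw [setLIntegral_subgraph hv hf.ennreal_ofReal]
  refine lintegral_mono fun x => ?_
  rcases le_or_gt (v x) 0 with hx | hx
  · simp [hG0 x hx]
  · calc ENNReal.ofReal (max (G x) 0) = ENNReal.ofReal (G x) := by simp [ENNReal.ofReal_max]
      _ ≤ ENNReal.ofReal (v x * g x) := ENNReal.ofReal_le_ofReal (hG1 x hx)
      _ = ∫⁻ t in Ioo 0 (v x), ENNReal.ofReal (g x) := by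
        rw [setLIntegral_const, Real.volume_Ioo, sub_zero, ENNReal.ofReal_mul hx.le, mul_comm]
      _ ≤ _ := setLIntegral_mono' measurableSet_Ioo fun t ht =>
        ENNReal.ofReal_le_ofReal (hgf x t ht.1 ht.2)

end Subgraph

theorem weight_anti {E : Type*} [NormedAddCommGroup E] (n : ℕ) {a b : ℝ} (ha : 0 < a)
    (hab : a ≤ b) (x : E) : weight n b x ≤ weight n a x := by
  unfold weight
  gcongr

theorem weight_add_ge {E : Type*} [NormedAddCommGroup E] (n : ℕ) {a h : ℝ} (ha : 0 < a)
    (hh : 0 ≤ h) (x : E) :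
    (1 - n * (h / (‖x‖ ^ 2 + a))) * weight n a x ≤ weight n (a + h) x := by
  have hs : 0 < ‖x‖ ^ 2 + a := by positivity
  have hsh : 0 < ‖x‖ ^ 2 + a + h := by positivity
  have hle : h / (‖x‖ ^ 2 + a + h) ≤ 1 := (div_le_one hsh).2 (by nlinarith [sq_nonneg ‖x‖])
  have hb := one_add_mul_le_pow (a := -(h / (‖x‖ ^ 2 + a + h))) (by linarith) n
  have heq : weight n (a + h) x
      = (1 + -(h / (‖x‖ ^ 2 + a + h))) ^ n * weight n a x := by
    have : 1 + -(h / (‖x‖ ^ 2 + a + h)) = (‖x‖ ^ 2 + a) / (‖x‖ ^ 2 + a + h) := by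
      field_simp; ring
    rw [this, weight, weight, div_pow, ← add_assoc]
    field_simp
  rw [heq]
  refine mul_le_mul_of_nonneg_right (le_trans ?_ hb) (weight_pos n ha x).le
  have : h / (‖x‖ ^ 2 + a + h) ≤ h / (‖x‖ ^ 2 + a) :=
    div_le_div_of_nonneg_left hh hs (by linarith)
  nlinarith [mul_le_mul_of_nonneg_left this (Nat.cast_nonneg (α := ℝ) n)]

section Bounds

variable {n : ℕ} {D ρ δ C : ℝ} {φ : EuclideanSpace ℝ (Fin (n-1)) → ℝ} {k : Fin (n-1) → ℝ}

theorem measurable_bubble_weight (n : ℕ) (D δ : ℝ) :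
    Measurable (fun p : EuclideanSpace ℝ (Fin (n-1)) × ℝ =>
      weight n ((p.2 + δ * D) ^ 2 - δ ^ 2) p.1) := by
  unfold weight
  fun_prop

theorem integrable_upper (hn : 4 ≤ n) (hD : 1 < D) (hδ : 0 < δ) (hk : ∀ i, 0 < k i) :
    Integrable (fun x : EuclideanSpace ℝ (Fin (n-1)) =>
      (∑ i, k i * x i ^ 2 + C * ‖x‖ ^ 3) * weight n (δ ^ 2 * (D ^ 2 - 1)) x) := by
  have ha : 0 < δ ^ 2 * (D ^ 2 - 1) := mul_pos (by positivity) (by nlinarith)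
  simp only [add_mul, mul_assoc]
  exact (integrable_quadratic_mul_weight hn ha hk).add
    ((integrable_norm_pow_mul_weight hn (j := 3) (by norm_num) ha).const_mul C)

theorem bubble_height_le (hD : 1 < D) (hδ : 0 < δ) {t : ℝ} (ht : 0 < t) :
    δ ^ 2 * (D ^ 2 - 1) ≤ (t + δ * D) ^ 2 - δ ^ 2 := by
  nlinarith [mul_pos ht (mul_pos hδ (one_pos.trans hD)), sq_nonneg t]

theorem subset_subgraph (hφ : ∀ x : EuclideanSpace ℝ (Fin (n-1)), ‖x‖ < ρ →
      |φ x - ∑ i, k i * (x i)^2| ≤ C * ‖x‖^3) :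
    ∀ p ∈ {p : EuclideanSpace ℝ (Fin (n-1)) × ℝ | ‖p.1‖ < ρ ∧ 0 < p.2 ∧ p.2 < φ p.1},
      0 < p.2 ∧ p.2 < ∑ i, k i * p.1 i ^ 2 + C * ‖p.1‖ ^ 3 := fun p hp =>
  ⟨hp.2.1, by linarith [hp.2.2, (abs_le.1 (hφ p.1 hp.1)).2]⟩

theorem bubble_weight_integral_le (hn : 4 ≤ n) (hD : 1 < D) (hδ : 0 < δ) (hk : ∀ i, 0 < k i)
    (hC : 0 < C) (hφ : ∀ x : EuclideanSpace ℝ (Fin (n-1)), ‖x‖ < ρ →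
      |φ x - ∑ i, k i * (x i)^2| ≤ C * ‖x‖^3) :
    let S := {p : EuclideanSpace ℝ (Fin (n-1)) × ℝ | ‖p.1‖ < ρ ∧ 0 < p.2 ∧ p.2 < φ p.1}
    let f := fun p : EuclideanSpace ℝ (Fin (n-1)) × ℝ => weight n ((p.2 + δ * D) ^ 2 - δ ^ 2) p.1
    IntegrableOn f S ∧ ∫ p in S, f p ≤ ∫ x : EuclideanSpace ℝ (Fin (n-1)),
      (∑ i, k i * x i ^ 2 + C * ‖x‖ ^ 3) * weight n (δ ^ 2 * (D ^ 2 - 1)) x := by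
  intro S f
  have ha : 0 < δ ^ 2 * (D ^ 2 - 1) := mul_pos (by positivity) (by nlinarith)
  have hu : Measurable fun x : EuclideanSpace ℝ (Fin (n-1)) =>
      ∑ i, k i * x i ^ 2 + C * ‖x‖ ^ 3 := by fun_prop
  have hu0 : ∀ x : EuclideanSpace ℝ (Fin (n-1)), 0 ≤ ∑ i, k i * x i ^ 2 + C * ‖x‖ ^ 3 := fun x =>
    add_nonneg (Finset.sum_nonneg fun i _ => mul_nonneg (hk i).le (sq_nonneg _)) (by positivity)
  have hf0 : ∀ x t, 0 < t → 0 ≤ f (x, t) := fun x t ht =>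
    (weight_pos n (ha.trans_le (bubble_height_le hD hδ ht)) x).le
  have hfg : ∀ x t, 0 < t → f (x, t) ≤ weight n (δ ^ 2 * (D ^ 2 - 1)) x := fun x t ht =>
    weight_anti n ha (bubble_height_le hD hδ ht) x
  exact ⟨integrableOn_of_subset_subgraph hu hu0 (measurable_bubble_weight n D δ) hf0
      (subset_subgraph hφ) hfg (integrable_upper hn hD hδ hk) fun x => (weight_pos n ha x).le,
    setIntegral_le_of_subset_subgraph hu hu0 (measurable_bubble_weight n D δ) hf0
      (subset_subgraph hφ) hfg (integrable_upper hn hD hδ hk) fun x => (weight_pos n ha x).le⟩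

theorem integrable_lower (hn : 4 ≤ n) {a : ℝ} (ha : 0 < a) (hk : ∀ i, 0 < k i) (c₃ c₄ c₂ : ℝ) :
    Integrable (fun x : EuclideanSpace ℝ (Fin (n-1)) =>
      (∑ i, k i * x i ^ 2 - c₃ * ‖x‖ ^ 3 - c₄ * ‖x‖ ^ 4 - c₂ * ‖x‖ ^ 2) * weight n a x) := by
  have h := fun j (hj : j ≤ 4) (c : ℝ) =>
    (integrable_norm_pow_mul_weight hn (j := j) hj ha).const_mul c
  simp only [sub_mul, mul_assoc]
  exact (((integrable_quadratic_mul_weight hn ha hk).sub (h 3 (by norm_num) c₃)).sub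
    (h 4 le_rfl c₄)).sub (h 2 (by norm_num) c₂)

theorem integral_lower_eq (hn : 4 ≤ n) {a : ℝ} (ha : 0 < a) (hk : ∀ i, 0 < k i) (c₃ c₄ c₂ : ℝ) :
    ∫ x : EuclideanSpace ℝ (Fin (n-1)),
        (∑ i, k i * x i ^ 2 - c₃ * ‖x‖ ^ 3 - c₄ * ‖x‖ ^ 4 - c₂ * ‖x‖ ^ 2) * weight n a x
      = (∫ x : EuclideanSpace ℝ (Fin (n-1)), (∑ i, k i * x i ^ 2) * weight n a x)
        - c₃ * (∫ x : EuclideanSpace ℝ (Fin (n-1)), ‖x‖ ^ 3 * weight n a x)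
        - c₄ * (∫ x : EuclideanSpace ℝ (Fin (n-1)), ‖x‖ ^ 4 * weight n a x)
        - c₂ * (∫ x : EuclideanSpace ℝ (Fin (n-1)), ‖x‖ ^ 2 * weight n a x) := by
  have h := fun j (hj : j ≤ 4) (c : ℝ) =>
    (integrable_norm_pow_mul_weight hn (j := j) hj ha).const_mul c
  have h0 := integrable_quadratic_mul_weight hn ha hk
  have h1 := h0.sub (h 3 (by norm_num) c₃)
  have h2 := h1.sub (h 4 le_rfl c₄)
  simp only [← integral_const_mul]
  rw [← integral_sub h0 (h 3 (by norm_num) c₃)]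
  refine Eq.trans ?_ (congrArg (· - _) (integral_sub h1 (h 4 le_rfl c₄)))
  refine Eq.trans ?_ (integral_sub h2 (h 2 (by norm_num) c₂))
  refine integral_congr_ae (ae_of_all _ fun x => ?_)
  ring

theorem le_bubble_weight_integral (hn : 4 ≤ n) (hD : 1 < D) (hρ : 0 < ρ) (hδ : 0 < δ)
    (hk : ∀ i, 0 < k i)
    (hC : 0 < C) (hφ : ∀ x : EuclideanSpace ℝ (Fin (n-1)), ‖x‖ < ρ →
      |φ x - ∑ i, k i * (x i)^2| ≤ C * ‖x‖^3) :
    let S := {p : EuclideanSpace ℝ (Fin (n-1)) × ℝ | ‖p.1‖ < ρ ∧ 0 < p.2 ∧ p.2 < φ p.1}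
    let K := ∑ i, k i
    ∫ x : EuclideanSpace ℝ (Fin (n-1)),
      (∑ i, k i * x i ^ 2 - (C + K / ρ) * ‖x‖ ^ 3 - n * K ^ 3 * ‖x‖ ^ 4
        - 2 * n * D * K ^ 2 * δ * ‖x‖ ^ 2) * weight n (δ ^ 2 * (D ^ 2 - 1)) x
      ≤ ∫ p in S, weight n ((p.2 + δ * D) ^ 2 - δ ^ 2) p.1 := by
  intro S K
  have ha : 0 < δ ^ 2 * (D ^ 2 - 1) := mul_pos (by positivity) (by nlinarith)
  have hD0 : 0 < D := one_pos.trans hD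
  have hK : 0 ≤ K := Finset.sum_nonneg fun i _ => (hk i).le
  have hq : ∀ x : EuclideanSpace ℝ (Fin (n-1)), ∑ i, k i * x i ^ 2 ≤ K * ‖x‖ ^ 2 := fun x =>
    (le_abs_self _).trans (abs_sum_mul_sq_le hk x)
  set v : EuclideanSpace ℝ (Fin (n-1)) → ℝ := fun x =>
    if ‖x‖ < ρ then ∑ i, k i * x i ^ 2 - C * ‖x‖ ^ 3 else 0 with hv
  have hvm : Measurable v :=
    Measurable.ite (measurableSet_lt measurable_norm measurable_const) (by fun_prop)
      measurable_const
  have hvpos : ∀ x, 0 < v x → ‖x‖ < ρ ∧ v x = ∑ i, k i * x i ^ 2 - C * ‖x‖ ^ 3 := fun x hx => by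
    by_cases h : ‖x‖ < ρ
    · exact ⟨h, if_pos h⟩
    · simp [hv, h] at hx
  have hC3 : ∀ x : EuclideanSpace ℝ (Fin (n-1)), 0 ≤ C * ‖x‖ ^ 3 := fun x => by positivity
  refine le_setIntegral_of_subgraph_subset (v := v)
    (g := fun x => (1 - n * ((v x ^ 2 + 2 * v x * δ * D) / (‖x‖ ^ 2 + δ ^ 2 * (D ^ 2 - 1))))
      * weight n (δ ^ 2 * (D ^ 2 - 1)) x)
    hvm (measurable_bubble_weight n D δ)
    (fun x t ht => (weight_pos n (ha.trans_le (bubble_height_le hD hδ ht)) x).le)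
    (fun p hp => hp.2.1) ?_ (bubble_weight_integral_le hn hD hδ hk hC hφ).1 ?_
    (integrable_lower hn ha hk _ _ _) ?_ ?_
  · rintro p ⟨hp0, hp⟩
    obtain ⟨h1, h2⟩ := hvpos _ (hp0.trans hp)
    exact ⟨h1, hp0, by linarith [(abs_le.1 (hφ p.1 h1)).1]⟩
  · intro x t ht htv
    have hv0 := ht.trans htv
    refine (weight_add_ge n ha (by positivity) x).trans
      (weight_anti n (ha.trans_le (bubble_height_le hD hδ ht)) ?_ x)
    have h1 : t * (δ * D) ≤ v x * (δ * D) := mul_le_mul_of_nonneg_right htv.le (by positivity)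
    nlinarith
  · intro x hx
    obtain ⟨h1, h2⟩ := hvpos x hx
    have hs : 0 < ‖x‖ ^ 2 + δ ^ 2 * (D ^ 2 - 1) := by positivity
    have hvK : v x ≤ K * ‖x‖ ^ 2 := by linarith [hq x, hC3 x]
    have hmain : v x * ((v x ^ 2 + 2 * v x * δ * D) / (‖x‖ ^ 2 + δ ^ 2 * (D ^ 2 - 1)))
        ≤ K ^ 3 * ‖x‖ ^ 4 + 2 * D * K ^ 2 * δ * ‖x‖ ^ 2 := by
      rw [← mul_div_assoc, div_le_iff₀ hs]
      have e3 := pow_le_pow_left₀ hx.le hvK 3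
      have e2 := mul_le_mul_of_nonneg_left (pow_le_pow_left₀ hx.le hvK 2)
        (show 0 ≤ 2 * δ * D by positivity)
      have e1 : 0 ≤ (K ^ 3 * ‖x‖ ^ 4 + 2 * D * K ^ 2 * δ * ‖x‖ ^ 2) * (δ ^ 2 * (D ^ 2 - 1)) :=
        mul_nonneg (by positivity) ha.le
      nlinarith
    have hρx : 0 ≤ K / ρ * ‖x‖ ^ 3 := by positivity
    rw [← mul_assoc]
    refine mul_le_mul_of_nonneg_right ?_ (weight_pos n ha x).le
    have := mul_le_mul_of_nonneg_left hmain (Nat.cast_nonneg (α := ℝ) n)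
    linarith
  · intro x hx
    refine mul_nonpos_of_nonpos_of_nonneg ?_ (weight_pos n ha x).le
    have h4 : 0 ≤ n * K ^ 3 * ‖x‖ ^ 4 := by positivity
    have h2 : 0 ≤ 2 * n * D * K ^ 2 * δ * ‖x‖ ^ 2 := by positivity
    have hρx : 0 ≤ K / ρ * ‖x‖ ^ 3 := by positivity
    by_cases h : ‖x‖ < ρ
    · have : v x = ∑ i, k i * x i ^ 2 - C * ‖x‖ ^ 3 := if_pos h
      linarith
    · have h3 : K * ‖x‖ ^ 2 ≤ K / ρ * ‖x‖ ^ 3 := by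
        rw [div_mul_eq_mul_div, le_div_iff₀ hρ]
        have := mul_le_mul_of_nonneg_left (not_lt.1 h) (show 0 ≤ K * ‖x‖ ^ 2 by positivity)
        linarith
      linarith [hq x, hC3 x]

theorem bubble_weight_integral_asymptotic (hn : 4 ≤ n) (hD : 1 < D) (hρ : 0 < ρ)
    (hk : ∀ i, 0 < k i)
    (hC : 0 < C) (hφ : ∀ x : EuclideanSpace ℝ (Fin (n-1)), ‖x‖ < ρ →
      |φ x - ∑ i, k i * (x i)^2| ≤ C * ‖x‖^3) :
    ∃ L : ℝ, ∀ δ : ℝ, 0 < δ → δ < 1 →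
      |δ ^ n * (∫ p in {p : EuclideanSpace ℝ (Fin (n-1)) × ℝ |
          ‖p.1‖ < ρ ∧ 0 < p.2 ∧ p.2 < φ p.1}, weight n ((p.2 + δ * D) ^ 2 - δ ^ 2) p.1)
        - δ * ((∑ i, k i) / ((n:ℝ) - 1) * beta2 n D)| ≤ L * δ ^ 2 := by
  set M : ℕ → ℝ := fun j =>
    ∫ x : EuclideanSpace ℝ (Fin (n-1)), ‖x‖ ^ j * weight n (D ^ 2 - 1) x with hM
  have ha : 0 < D ^ 2 - 1 := by nlinarith
  have hM0 : ∀ j, 0 ≤ M j := fun j => integral_nonneg fun x =>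
    mul_nonneg (by positivity) (weight_pos n ha x).le
  set K := ∑ i, k i with hK
  have hK0 : 0 ≤ K := Finset.sum_nonneg fun i _ => (hk i).le
  have hD0 : 0 < D := one_pos.trans hD
  refine ⟨(C + K / ρ) * M 3 + n * K ^ 3 * M 4 + 2 * n * D * K ^ 2 * M 2, fun δ hδ hδ1 => ?_⟩
  have haδ : 0 < δ ^ 2 * (D ^ 2 - 1) := by positivity
  have hup := (bubble_weight_integral_le hn hD hδ hk hC hφ).2
  have hlo := le_bubble_weight_integral hn hD hρ hδ hk hC hφ
  simp only at hup hlo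
  set I := ∫ p in {p : EuclideanSpace ℝ (Fin (n-1)) × ℝ |
          ‖p.1‖ < ρ ∧ 0 < p.2 ∧ p.2 < φ p.1}, weight n ((p.2 + δ * D) ^ 2 - δ ^ 2) p.1 with hI
  have hup' := integral_lower_eq hn haδ hk (-C) 0 0
  simp only [neg_mul, sub_neg_eq_add, zero_mul, sub_zero] at hup'
  rw [hup'] at hup
  rw [integral_lower_eq hn haδ hk] at hlo
  have hq := integral_homogeneous_mul_weight (n := n) (j := 2) (by omega) (D ^ 2 - 1) hδ
    (P := fun x => ∑ i, k i * x i ^ 2) fun x => by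
      simp only [PiLp.smul_apply, smul_eq_mul, Finset.mul_sum]
      exact Finset.sum_congr rfl fun i _ => by ring
  have hj := fun j : ℕ => integral_homogeneous_mul_weight (n := n) (j := j) (by omega)
    (D ^ 2 - 1) hδ (P := fun x => ‖x‖ ^ j) fun x => by
      rw [norm_smul, Real.norm_eq_abs, abs_of_pos hδ, mul_pow]
  rw [integral_quadratic_mul_weight hn hD k] at hq
  have h3 := hj 3
  have h4 := hj 4
  have h2 := hj 2
  change _ = δ ^ 2 * M 2 at h2
  change _ = δ ^ 3 * M 3 at h3
  change _ = δ ^ 4 * M 4 at h4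
  set B := K / ((n:ℝ) - 1) * beta2 n D with hB
  have hpow : (0:ℝ) ≤ δ ^ (n + 1) := by positivity
  have hup2 := mul_le_mul_of_nonneg_left hup hpow
  have hlo2 := mul_le_mul_of_nonneg_left hlo hpow
  rw [pow_succ] at hup2 hlo2 hq h2 h3 h4
  have hc3 : 0 ≤ K / ρ * M 3 := mul_nonneg (by positivity) (hM0 3)
  have hc4 : 0 ≤ n * K ^ 3 * M 4 := mul_nonneg (by positivity) (hM0 4)
  have hc2 : 0 ≤ 2 * n * D * K ^ 2 * M 2 := mul_nonneg (by positivity) (hM0 2)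
  have h43 : n * K ^ 3 * M 4 * δ ^ 4 ≤ n * K ^ 3 * M 4 * δ ^ 3 :=
    mul_le_mul_of_nonneg_left (pow_le_pow_of_le_one hδ.le hδ1.le (by norm_num)) hc4
  have hδ3 : 0 < δ ^ 3 := by positivity
  have hr : δ * (δ ^ n * I) ≤ δ * (δ * B) + δ ^ 3 * (C * M 3) := by
    linear_combination hup2 + hq + C * h3
  have hl : δ * (δ * B) - δ ^ 3 * ((C + K / ρ) * M 3 + 2 * n * D * K ^ 2 * M 2)
      - n * K ^ 3 * M 4 * δ ^ 4 ≤ δ * (δ ^ n * I) := by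
    linear_combination hlo2 - hq + (C + K / ρ) * h3 + n * K ^ 3 * h4
      + 2 * n * D * K ^ 2 * δ * h2
  rw [abs_le]
  constructor
  · refine le_of_mul_le_mul_left ?_ hδ
    linarith
  · refine le_of_mul_le_mul_left ?_ hδ
    nlinarith [mul_nonneg hδ3.le hc3, mul_nonneg hδ3.le hc4, mul_nonneg hδ3.le hc2]

end Bounds

theorem stmt_12 (n : ℕ) (hn : 4 ≤ n) (D ρ : ℝ) (hD : 1 < D) (hρ : 0 < ρ)
    (φ : EuclideanSpace ℝ (Fin (n-1)) → ℝ) (k : Fin (n-1) → ℝ) (C₀ : ℝ)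
    (hk : ∀ i, 0 < k i) (hC₀ : 0 < C₀)
    (hφ0 : ∀ x : EuclideanSpace ℝ (Fin (n-1)), ‖x‖ < ρ → 0 ≤ φ x)
    (hφ : ∀ x : EuclideanSpace ℝ (Fin (n-1)), ‖x‖ < ρ →
      |φ x - ∑ i, k i * (x i)^2| ≤ C₀ * ‖x‖^3) :
    (fun δ : ℝ =>
      (∫ x in {p : EuclideanSpace ℝ (Fin (n-1)) × ℝ | ‖p.1‖ < ρ ∧ 0 < p.2 ∧ p.2 < φ p.1},
          (bubble n D δ 0 x) ^ ((2*(n:ℝ))/((n:ℝ)-2)))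
        - δ * (alphaN n) ^ ((2*(n:ℝ))/((n:ℝ)-2)) * ((∑ i, k i)/((n:ℝ)-1)) * beta2 n D)
      =O[𝓝[>] (0:ℝ)] (fun δ : ℝ => δ^2) := by
  obtain ⟨L, hL⟩ := bubble_weight_integral_asymptotic hn hD hρ hk hC₀ hφ
  refine IsBigO.of_bound (|alphaN n ^ ((2*(n:ℝ))/((n:ℝ)-2))| * L) ?_
  filter_upwards [Ioo_mem_nhdsGT (zero_lt_one (α := ℝ))] with δ hδ
  have hae : ∀ᵐ p ∂((volume : Measure (EuclideanSpace ℝ (Fin (n-1)) × ℝ)).restrict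
      {p | ‖p.1‖ < ρ ∧ 0 < p.2 ∧ p.2 < φ p.1}),
      bubble n D δ 0 p ^ ((2*(n:ℝ))/((n:ℝ)-2))
        = alphaN n ^ ((2*(n:ℝ))/((n:ℝ)-2)) * δ ^ n
          * weight n ((p.2 + δ * D) ^ 2 - δ ^ 2) p.1 :=
    (ae_restrict_of_snd_pos fun p hp => hp.2.1).mono fun p hp =>
      bubble_rpow (by omega) hD hδ.1 hp p.1
  rw [integral_congr_ae hae, integral_const_mul, Real.norm_eq_abs, Real.norm_eq_abs,
    abs_of_pos (pow_pos hδ.1 2), mul_assoc (|_|)]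
  refine le_trans (le_of_eq ?_) (mul_le_mul_of_nonneg_left (hL δ hδ.1 hδ.2) (abs_nonneg _))
  rw [← abs_mul]
  congr 1
  ring
end
end

section
/- Let n ≥ 5 be an integer, D > 1 and ρ > 0. Then, as δ → 0⁺, ∫_{C(0,ρ)} U_{δ,0}(x)² dx = δ² ∫_{ℝⁿ₊} U₁(y)² dy + O(δ^{n−2}). -/
open MeasureTheory Real Set Filter Asymptotics Topology

noncomputable section

lemma sq_rpow_half_natCast_sub_two {n : ℕ} (hn : 2 ≤ n) {a : ℝ} (ha : 0 ≤ a) :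
    (a ^ (((n:ℝ)-2)/2)) ^ 2 = a ^ (n-2) := by
  rw [← Real.rpow_natCast, ← Real.rpow_mul ha, ← Real.rpow_natCast a (n-2), Nat.cast_sub hn]
  congr 1
  push_cast
  ring

lemma norm_sq_add_le_bubble_denom {E : Type*} [SeminormedAddCommGroup E] {D δ : ℝ} (hD : 1 < D)
    (hδ : 0 < δ) {x : E × ℝ} (hx : 0 < x.2) :
    ‖x‖^2 + δ^2 * (D^2 - 1) ≤ ‖x.1‖^2 + (x.2 + δ*D)^2 - δ^2 := by
  have h1 : ‖x‖^2 ≤ ‖x.1‖^2 + x.2^2 := by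
    rw [Prod.norm_def, Real.norm_of_nonneg hx.le]
    rcases max_cases ‖x.1‖ x.2 with ⟨h, -⟩ | ⟨h, -⟩ <;> rw [h] <;>
      nlinarith [sq_nonneg x.2, sq_nonneg ‖x.1‖]
  have h2 : 0 ≤ x.2 * (δ * D) := by positivity
  nlinarith

lemma bubble_zero_sq {n : ℕ} (hn : 2 ≤ n) {D δ : ℝ} (hD : 1 < D) (hδ : 0 < δ)
    {x : EuclideanSpace ℝ (Fin (n-1)) × ℝ} (hx : 0 < x.2) :
    bubble n D δ 0 x ^ 2 =
      alphaN n ^ 2 * δ ^ (n-2) / (‖x.1‖^2 + (x.2 + δ*D)^2 - δ^2) ^ (n-2) := by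
  have h := norm_sq_add_le_bubble_denom hD hδ hx
  have hD2 : 0 < D^2 - 1 := by nlinarith
  have hQ : 0 ≤ ‖x.1‖^2 + (x.2 + δ*D)^2 - δ^2 := le_trans (by positivity) h
  rw [bubble, sub_zero, div_pow, mul_pow, sq_rpow_half_natCast_sub_two hn hδ.le,
    sq_rpow_half_natCast_sub_two hn hQ]

lemma bubble_zero_sq_le {n : ℕ} (hn : 2 ≤ n) {D δ k : ℝ} (hD : 1 < D) (hδ : 0 < δ) (hk : 0 < k)
    {x : EuclideanSpace ℝ (Fin (n-1)) × ℝ} (hx : 0 < x.2)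
    (h : k * (1 + ‖x‖^2) ≤ ‖x‖^2 + δ^2 * (D^2 - 1)) :
    bubble n D δ 0 x ^ 2 ≤
      alphaN n ^ 2 * (k ^ (n-2))⁻¹ * ((1 + ‖x‖^2) ^ (n-2))⁻¹ * δ ^ (n-2) := by
  rw [bubble_zero_sq hn hD hδ hx]
  have h' := h.trans (norm_sq_add_le_bubble_denom hD hδ hx)
  calc _ ≤ alphaN n ^ 2 * δ ^ (n-2) / (k * (1 + ‖x‖^2)) ^ (n-2) := by gcongr
    _ = _ := by rw [mul_pow, div_eq_mul_inv, mul_inv]; ring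

instance isAddHaarMeasure_volume_euclideanSpace_prod (m : ℕ) :
    (volume : Measure (EuclideanSpace ℝ (Fin m) × ℝ)).IsAddHaarMeasure :=
  inferInstanceAs
    ((volume : Measure (EuclideanSpace ℝ (Fin m))).prod (volume : Measure ℝ)).IsAddHaarMeasure

lemma integrable_inv_one_add_norm_sq_pow {n : ℕ} (hn : 5 ≤ n) :
    Integrable (fun x : EuclideanSpace ℝ (Fin (n-1)) × ℝ => ((1 + ‖x‖^2) ^ (n-2))⁻¹) := by
  have hr : (Module.finrank ℝ (EuclideanSpace ℝ (Fin (n-1)) × ℝ) : ℝ) < ((2 * (n-2) : ℕ) : ℝ) := by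
    rw [Module.finrank_prod, finrank_euclideanSpace_fin, Module.finrank_self]
    exact_mod_cast (by omega : n - 1 + 1 < 2 * (n-2))
  refine (integrable_rpow_neg_one_add_norm_sq (μ := volume) hr).congr (.of_forall fun x => ?_)
  have hp : (0:ℝ) ≤ 1 + ‖x‖^2 := by positivity
  change (1 + ‖x‖^2) ^ (-((2 * (n-2) : ℕ) : ℝ) / 2) = ((1 + ‖x‖^2) ^ (n-2))⁻¹
  rw [← Real.rpow_natCast (1 + ‖x‖^2) (n-2), ← Real.rpow_neg hp]
  congr 1
  push_cast
  ring

lemma measurable_bubble (n : ℕ) (D δ : ℝ) (ξ : EuclideanSpace ℝ (Fin (n-1))) :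
    Measurable (bubble n D δ ξ) := by
  unfold bubble
  fun_prop

lemma measurableSet_upperHalfSpace (n : ℕ) :
    MeasurableSet {y : EuclideanSpace ℝ (Fin (n-1)) × ℝ | 0 < y.2} :=
  measurableSet_lt measurable_const measurable_snd

lemma integrableOn_bubble_sq {n : ℕ} (hn : 5 ≤ n) {D δ : ℝ} (hD : 1 < D) (hδ : 0 < δ) :
    IntegrableOn (fun x => bubble n D δ 0 x ^ 2)
      {y : EuclideanSpace ℝ (Fin (n-1)) × ℝ | 0 < y.2} := by
  have hD2 : 0 < D^2 - 1 := by nlinarith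
  have hk : 0 < min 1 (δ^2 * (D^2 - 1)) := lt_min one_pos (by positivity)
  refine Integrable.mono' (((integrable_inv_one_add_norm_sq_pow hn).const_mul
    (alphaN n ^ 2 * (min 1 (δ^2 * (D^2 - 1)) ^ (n-2))⁻¹)).mul_const (δ ^ (n-2))).integrableOn
    ((measurable_bubble n D δ 0).pow_const 2).aestronglyMeasurable
    ((ae_restrict_iff' (measurableSet_upperHalfSpace n)).2 (.of_forall fun x hx => ?_))
  rw [Real.norm_of_nonneg (sq_nonneg _)]
  refine bubble_zero_sq_le (by omega) hD hδ hk hx ?_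
  nlinarith [min_le_left 1 (δ^2 * (D^2 - 1)), min_le_right 1 (δ^2 * (D^2 - 1)), sq_nonneg ‖x‖]

open scoped Pointwise in
lemma setIntegral_upperHalfSpace_bubble_sq {n : ℕ} (hn : 2 ≤ n) {D δ : ℝ} (hD : 1 < D)
    (hδ : 0 < δ) :
    ∫ y in {y : EuclideanSpace ℝ (Fin (n-1)) × ℝ | 0 < y.2}, bubble n D δ 0 y ^ 2 =
      δ^2 * ∫ y in {y : EuclideanSpace ℝ (Fin (n-1)) × ℝ | 0 < y.2}, bubble n D 1 0 y ^ 2 := by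
  set S := {y : EuclideanSpace ℝ (Fin (n-1)) × ℝ | 0 < y.2} with hS
  have hsmul : δ • S = S := by
    ext y
    rw [Set.mem_smul_set_iff_inv_smul_mem₀ hδ.ne']
    simp [hS, hδ]
  have h := Measure.setIntegral_comp_smul_of_pos volume
    (fun x : EuclideanSpace ℝ (Fin (n-1)) × ℝ => bubble n D δ 0 x ^ 2) S hδ
  have hscale : ∀ y ∈ S, bubble n D δ 0 (δ • y) ^ 2 = (δ ^ (n-2))⁻¹ * bubble n D 1 0 y ^ 2 := by
    intro y hy
    have hy' : 0 < (δ • y).2 := mul_pos hδ hy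
    rw [bubble_zero_sq hn hD hδ hy', bubble_zero_sq hn hD one_pos hy]
    have : ‖(δ • y).1‖^2 + ((δ • y).2 + δ*D)^2 - δ^2 =
        δ^2 * (‖y.1‖^2 + (y.2 + 1*D)^2 - 1^2) := by
      rw [Prod.smul_fst, norm_smul, Real.norm_of_nonneg hδ.le, Prod.smul_snd, smul_eq_mul]
      ring
    rw [this, mul_pow, ← pow_mul, mul_comm 2 (n-2), pow_mul, one_pow, one_pow, sq (δ ^ (n-2))]
    have hne : δ ^ (n-2) ≠ 0 := by positivity
    field_simp
  have hfin : Module.finrank ℝ (EuclideanSpace ℝ (Fin (n-1)) × ℝ) = (n-2) + 2 := by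
    rw [Module.finrank_prod, finrank_euclideanSpace_fin, Module.finrank_self]
    omega
  rw [setIntegral_congr_fun (measurableSet_upperHalfSpace n) hscale, hsmul, hfin,
    integral_const_mul, smul_eq_mul, pow_add] at h
  have hne : δ ^ (n-2) ≠ 0 := by positivity
  field_simp at h
  linarith

theorem stmt_18 (n : ℕ) (hn : 5 ≤ n) (D ρ : ℝ) (hD : 1 < D) (hρ : 0 < ρ) :
    (fun δ : ℝ =>
      (∫ x in {p : EuclideanSpace ℝ (Fin (n-1)) × ℝ | ‖p.1‖ < ρ ∧ 0 < p.2 ∧ p.2 < ρ},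
          (bubble n D δ 0 x)^2)
        - δ^2 * ∫ y in {y : EuclideanSpace ℝ (Fin (n-1)) × ℝ | 0 < y.2},
            (bubble n D 1 0 y)^2)
      =O[𝓝[>] (0:ℝ)] (fun δ : ℝ => δ^((n:ℕ)-2)) := by
  have hn2 : 2 ≤ n := by omega
  set S := {y : EuclideanSpace ℝ (Fin (n-1)) × ℝ | 0 < y.2} with hS
  set C := {p : EuclideanSpace ℝ (Fin (n-1)) × ℝ | ‖p.1‖ < ρ ∧ 0 < p.2 ∧ p.2 < ρ} with hC
  have hCS : C ⊆ S := fun p hp => hp.2.1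
  have hSm : MeasurableSet S := measurableSet_upperHalfSpace n
  have hCm : MeasurableSet C :=
    (measurableSet_lt measurable_fst.norm measurable_const).inter
      (hSm.inter (measurableSet_lt measurable_snd measurable_const))
  set k := ρ^2 / (1 + ρ^2) with hk_def
  have hk : 0 < k := by positivity
  set G : EuclideanSpace ℝ (Fin (n-1)) × ℝ → ℝ :=
    fun x => alphaN n ^ 2 * (k ^ (n-2))⁻¹ * ((1 + ‖x‖^2) ^ (n-2))⁻¹ with hG
  have hGi : Integrable G := (integrable_inv_one_add_norm_sq_pow hn).const_mul _
  refine IsBigO.of_bound (∫ x in S \ C, G x) ?_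
  filter_upwards [self_mem_nhdsWithin] with δ hδ
  replace hδ : 0 < δ := hδ
  have hi := integrableOn_bubble_sq hn hD hδ
  have hdiff := setIntegral_sdiff hCm hi hCS
  rw [← setIntegral_upperHalfSpace_bubble_sq hn2 hD hδ, norm_sub_rev, ← hdiff,
    Real.norm_of_nonneg (integral_nonneg fun x => sq_nonneg _),
    Real.norm_of_nonneg (by positivity), ← integral_mul_const]
  refine setIntegral_mono_on (hi.mono_set sdiff_subset) (hGi.mul_const _).integrableOn
    (hSm.diff hCm) fun x hx => bubble_zero_sq_le hn2 hD hδ hk hx.1 ?_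
  have hρx : ρ ≤ ‖x‖ := by
    by_contra! hlt
    rw [Prod.norm_def, max_lt_iff] at hlt
    exact hx.2 ⟨hlt.1, hx.1, (le_abs_self _).trans_lt hlt.2⟩
  have hsq : ρ^2 ≤ ‖x‖^2 := by gcongr
  have hD2 : 0 < D^2 - 1 := by nlinarith
  have hle : k * (1 + ‖x‖^2) ≤ ‖x‖^2 := by
    rw [hk_def, div_mul_eq_mul_div, div_le_iff₀ (by positivity)]
    nlinarith
  have : 0 ≤ δ^2 * (D^2 - 1) := by positivity
  linarith
end
end
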